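/- Let G be a non-hamiltonian 1-tough graph on n ≥ 3 vertices with σ₃(G) ≥ n, C a longest cycle, u ∉ V(C), v ∈ V(C) with v⁺, v⁻ ∈ N(u), and B = N(u) ∪ N(v). Then B⁺ ∪ (V(G)−V(C)) and B⁻ ∪ (V(G)−V(C)) are independent sets in G. -/

import Mathlib

open scoped Classical

namespace Paper

noncomputable section

variable {V : Type*}

/-- degree as cardinality of neighbor set -/
def deg (G : SimpleGraph V) (x : V) : ℕ := (G.neighborSet x).ncard

/-- G is 1-tough -/
def OneTough (G : SimpleGraph V) : Prop :=
  ∀ S : Set V, S.Nonempty → Nat.card ((G.induce Sᶜ).ConnectedComponent) ≤ S.ncard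

def IsIndepTriple (G : SimpleGraph V) (s : Finset V) : Prop :=
  s.card = 3 ∧ ∀ x ∈ s, ∀ y ∈ s, x ≠ y → ¬ G.Adj x y

def sigma3 [Fintype V] (G : SimpleGraph V) : ℕ :=
  if ∃ s : Finset V, IsIndepTriple G s then
    sInf {k | ∃ s : Finset V, IsIndepTriple G s ∧ ∑ x ∈ s, deg G x = k}
  else 3 * (Fintype.card V - 1)

def NC2 [Fintype V] (G : SimpleGraph V) : ℕ :=
  if G = ⊤ then Fintype.card V - 1
  else sInf {k | ∃ x y : V, G.dist x y = 2 ∧ (G.neighborSet x ∪ G.neighborSet y).ncard = k}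

def circumference (G : SimpleGraph V) : ℕ :=
  sSup {k | ∃ (a : V) (w : G.Walk a a), w.IsCycle ∧ w.length = k}

def IsLongestCycle (G : SimpleGraph V) {a : V} (c : G.Walk a a) : Prop :=
  c.IsCycle ∧ ∀ (b : V) (w : G.Walk b b), w.IsCycle → w.length ≤ c.length

/-- successor of a vertex along the oriented cycle `c` (identity off the cycle) -/
def cSucc [DecidableEq V] {G : SimpleGraph V} {a : V} (c : G.Walk a a) (x : V) : V :=
  if h : x ∈ c.support.tail then c.support.tail.next x h else x

/-- predecessor of a vertex along the oriented cycle `c` (identity off the cycle) -/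
def cPred [DecidableEq V] {G : SimpleGraph V} {a : V} (c : G.Walk a a) (x : V) : V :=
  if h : x ∈ c.support.tail then c.support.tail.prev x h else x

/-- vertices strictly between `x` and `y` going forward along `c` -/
def arc [DecidableEq V] {G : SimpleGraph V} {a : V} (c : G.Walk a a) (x y : V) : Set V :=
  {z | ∃ i k : ℕ, 0 < i ∧ i < k ∧ k < c.length ∧ (cSucc c)^[k] x = y ∧ z = (cSucc c)^[i] x}

/-- length of the interval of the cycle `c` starting at `b` determined by `B` -/
def intervalLen [DecidableEq V] {G : SimpleGraph V} {a : V} (c : G.Walk a a)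
    (B : Set V) (b : V) : ℕ :=
  sInf {k | 0 < k ∧ (cSucc c)^[k] b ∈ B}

/-- inner vertices of the interval of the cycle `c` starting at `b` determined by `B` -/
def innerVerts [DecidableEq V] {G : SimpleGraph V} {a : V} (c : G.Walk a a)
    (B : Set V) (b : V) : Set V :=
  {x | ∃ i, 0 < i ∧ i < intervalLen c B b ∧ x = (cSucc c)^[i] b}

/-- the union of the neighborhoods of the vertices in `S` -/
def nbhdSet (G : SimpleGraph V) (S : Set V) : Set V := {z | ∃ y ∈ S, G.Adj y z}

/-- a set of vertices is independent -/
def IsIndepSet (G : SimpleGraph V) (S : Set V) : Prop :=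
  ∀ x ∈ S, ∀ y ∈ S, ¬ G.Adj x y

/-- `G` has a path from `a` to `b` with vertex set `S`. -/
def HasPath [DecidableEq V] (G : SimpleGraph V) (a b : V) (S : Finset V) : Prop :=
  ∃ p : G.Walk a b, p.IsPath ∧ p.support.toFinset = S

/-- `a` and `b` are joined by an edge (`S = ∅`) or through a path with vertex set `S`. -/
def Linked [DecidableEq V] (G : SimpleGraph V) (a b : V) (S : Finset V) : Prop :=
  (S = ∅ ∧ G.Adj a b) ∨ ∃ x y, G.Adj a x ∧ HasPath G x y S ∧ G.Adj y b

section Paths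

variable [DecidableEq V] {G : SimpleGraph V}

theorem HasPath.single (a : V) : HasPath G a a {a} := ⟨.nil, by simp, by simp⟩

theorem HasPath.symm {a b : V} {S : Finset V} (h : HasPath G a b S) : HasPath G b a S := by
  obtain ⟨p, hp, rfl⟩ := h
  exact ⟨p.reverse, hp.reverse, by simp⟩

theorem HasPath.append {a b x y : V} {S T : Finset V} (h : HasPath G a b S) (hbx : G.Adj b x)
    (h' : HasPath G x y T) (hd : Disjoint S T) : HasPath G a y (S ∪ T) := by
  obtain ⟨p, hp, rfl⟩ := h
  obtain ⟨q, hq, rfl⟩ := h'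
  have hs : (p.append (.cons hbx q)).support = p.support ++ q.support := by
    simp [SimpleGraph.Walk.support_append]
  refine ⟨p.append (.cons hbx q), ?_, by rw [hs, List.toFinset_append]⟩
  rw [SimpleGraph.Walk.isPath_def, hs, List.nodup_append']
  refine ⟨hp.support_nodup, hq.support_nodup, fun z hz hz' => ?_⟩
  exact Finset.disjoint_left.mp hd (by simpa using hz) (by simpa using hz')

theorem Linked.edge {a b : V} (h : G.Adj a b) : Linked G a b ∅ := .inl ⟨rfl, h⟩

theorem Linked.one {a x b : V} (h : G.Adj a x) (h' : G.Adj x b) : Linked G a b {x} :=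
  .inr ⟨x, x, h, .single x, h'⟩

theorem Linked.two {a x y b : V} (h : G.Adj a x) (hxy : G.Adj x y) (h' : G.Adj y b) :
    Linked G a b {x, y} :=
  .inr ⟨x, y, h, HasPath.append (.single x) hxy (.single y) (by simpa using hxy.ne), h'⟩

theorem Linked.three {a x y z b : V} (h : G.Adj a x) (hxy : G.Adj x y) (hyz : G.Adj y z)
    (hzx : z ≠ x) (h' : G.Adj z b) : Linked G a b ({x} ∪ {y, z}) := by
  refine .inr ⟨x, z, h, HasPath.append (.single x) hxy
    (HasPath.append (.single y) hyz (.single z) (by simpa using hyz.ne)) ?_, h'⟩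
  simp [hxy.ne, hzx.symm]

theorem Linked.symm {a b : V} {S : Finset V} (h : Linked G a b S) : Linked G b a S := by
  rcases h with ⟨rfl, h⟩ | ⟨x, y, h1, h2, h3⟩
  · exact .inl ⟨rfl, h.symm⟩
  · exact .inr ⟨y, x, h3.symm, h2.symm, h1.symm⟩

theorem HasPath.append_linked {a b x y : V} {S T R : Finset V} (h : HasPath G a b S)
    (hl : Linked G b x R) (h' : HasPath G x y T) (hST : Disjoint S T) (hSR : Disjoint S R)
    (hTR : Disjoint T R) : HasPath G a y (S ∪ R ∪ T) := by
  rcases hl with ⟨rfl, hbx⟩ | ⟨s, t, h1, h2, h3⟩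
  · simpa using h.append hbx h' hST
  · exact (h.append h1 h2 hSR).append h3 h' (Finset.disjoint_union_left.mpr ⟨hST, hTR.symm⟩)

end Paths

/-- `c` runs periodically around a cycle of `G` of length `m`, and no cycle is longer. -/
structure IsMaxCycle [DecidableEq V] (G : SimpleGraph V) (m : ℕ) (c : ℤ → V) : Prop where
  three_le : 3 ≤ m
  dvd_of_eq : ∀ i j, c i = c j → (m : ℤ) ∣ i - j
  periodic : ∀ i, c (i + m) = c i
  adj : ∀ i, G.Adj (c i) (c (i + 1))
  max : ∀ a b S, HasPath G a b S → G.Adj b a → S.card ≤ m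

/-- `t` does not lie on the cycle traversed by `c`. -/
def OffCycle (c : ℤ → V) (t : V) : Prop := ∀ i, t ≠ c i

namespace IsMaxCycle

variable [DecidableEq V] {G : SimpleGraph V} {m : ℕ} {c : ℤ → V}

theorem ne (h : IsMaxCycle G m c) {i j : ℤ} (hij : i < j) (hj : j < i + m) : c i ≠ c j := by
  intro he
  have h1 := h.dvd_of_eq _ _ he.symm
  have := Int.le_of_dvd (by omega) h1
  omega

theorem reverse (h : IsMaxCycle G m c) : IsMaxCycle G m (fun i => c (-i)) where
  three_le := h.three_le
  dvd_of_eq i j he := by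
    have := h.dvd_of_eq _ _ he
    rwa [show -i - -j = -(i - j) by ring, dvd_neg] at this
  periodic i := by
    have := h.periodic (-(i + m))
    simpa using this.symm
  adj i := by
    have := h.adj (-(i + 1))
    simpa using this.symm
  max := h.max

theorem shift (h : IsMaxCycle G m c) (k : ℤ) : IsMaxCycle G m (fun i => c (i + k)) where
  three_le := h.three_le
  dvd_of_eq i j he := by simpa using h.dvd_of_eq _ _ he
  periodic i := by
    have := h.periodic (i + k)
    rwa [add_right_comm] at this
  adj i := by
    have := h.adj (i + k)
    rwa [add_right_comm] at this
  max := h.max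

theorem exists_eq_mem_Ico (h : IsMaxCycle G m c) (k i : ℤ) :
    ∃ j, k ≤ j ∧ j < k + m ∧ c i = c j ∧ (m : ℤ) ∣ i - j := by
  have hm : (0 : ℤ) < m := by have := h.three_le; omega
  have hper : ∀ (q : ℕ) (x : ℤ), c (x + q * m) = c x := by
    intro q
    induction q with
    | zero => simp
    | succ q ih =>
      intro x
      have := h.periodic (x + q * m)
      rw [ih] at this
      rw [← this]
      push_cast
      ring_nf
  have hper' : ∀ (q : ℤ) (x : ℤ), c (x + q * m) = c x := by
    intro q x
    obtain ⟨n, rfl | rfl⟩ := q.eq_nat_or_neg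
    · exact hper n x
    · have := hper n (x + -n * m)
      rw [← this]
      congr 1
      ring
  refine ⟨k + (i - k) % m, ?_, ?_, ?_, ?_⟩
  · have := Int.emod_nonneg (i - k) hm.ne'
    omega
  · have := Int.emod_lt_of_pos (i - k) hm
    omega
  · have := hper' ((i - k) / m) (k + (i - k) % m)
    rw [← this]
    congr 1
    have := Int.emod_add_mul_ediv (i - k) m
    linarith
  · have := Int.emod_add_mul_ediv (i - k) m
    exact ⟨(i - k) / m, by linarith⟩

theorem hasPath_segment (h : IsMaxCycle G m c) {i j : ℤ} (hij : i ≤ j) (hj : j < i + m) :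
    HasPath G (c i) (c j) ((Finset.Icc i j).image c) := by
  induction j, hij using Int.leInduction with
  | base => simpa using HasPath.single (G := G) (c i)
  | succ j hij ih =>
    have := (ih (by omega)).append (h.adj j) (.single _) (by
      simp only [Finset.disjoint_singleton_right, Finset.mem_image, Finset.mem_Icc, not_exists]
      rintro x ⟨hx, he⟩
      exact h.ne (by omega) (by omega) he)
    have he : Finset.Icc i (j + 1) = Finset.Icc i j ∪ {j + 1} := by
      ext x
      simp only [Finset.mem_union, Finset.mem_Icc, Finset.mem_singleton]
      omega
    rw [he, Finset.image_union, Finset.image_singleton]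
    exact this

theorem card_segment (h : IsMaxCycle G m c) {i j : ℤ} (hij : i ≤ j) (hj : j < i + m) :
    (((Finset.Icc i j).image c).card : ℤ) = j - i + 1 := by
  rw [Finset.card_image_of_injOn]
  · simp
    omega
  · intro x hx y hy hxy
    simp only [Finset.coe_Icc, Set.mem_Icc] at hx hy
    rcases lt_trichotomy x y with hlt | hlt | hlt
    · exact absurd hxy (h.ne hlt (by omega))
    · exact hlt
    · exact absurd hxy.symm (h.ne hlt (by omega))

theorem disjoint_segment (h : IsMaxCycle G m c) {i j k l : ℤ} (hjk : j < k) (hl : l < i + m) :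
    Disjoint ((Finset.Icc i j).image c) ((Finset.Icc k l).image c) := by
  simp only [Finset.disjoint_left, Finset.mem_image, Finset.mem_Icc, not_exists]
  rintro _ ⟨x, hx, rfl⟩ y ⟨hy, he⟩
  exact h.ne (i := x) (j := y) (by omega) (by omega) he.symm

theorem _root_.Paper.disjoint_segment_off {S : Finset V} (hS : ∀ t ∈ S, OffCycle c t) (i j : ℤ) :
    Disjoint ((Finset.Icc i j).image c) S := by
  simp only [Finset.disjoint_left, Finset.mem_image]
  rintro _ ⟨x, -, rfl⟩ hx
  exact hS _ hx x rfl

theorem card_le_of_linked (h : IsMaxCycle G m c) {a b : V} {S T : Finset V}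
    (hp : HasPath G a b S) (hl : Linked G b a T) (hd : Disjoint S T) : S.card + T.card ≤ m := by
  rcases hl with ⟨rfl, hab⟩ | ⟨x, y, h1, h2, h3⟩
  · simpa using h.max _ _ _ hp hab
  · rw [← Finset.card_union_of_disjoint hd]
    exact h.max _ _ _ (hp.append h1 h2 hd) h3

theorem detour (h : IsMaxCycle G m c) {i j : ℤ} {S : Finset V} (hS : ∀ t ∈ S, OffCycle c t)
    (hl : Linked G (c i) (c j) S) (hij : i < j) (hj : j ≤ i + m) : (S.card : ℤ) + 1 ≤ j - i := by
  rw [← h.periodic i] at hl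
  have h1 := h.card_le_of_linked (h.hasPath_segment hj (by omega)) hl (disjoint_segment_off hS _ _)
  have h2 := h.card_segment hj (by omega)
  omega

theorem crossing (h : IsMaxCycle G m c) {i j k l : ℤ} {S T : Finset V}
    (hS : ∀ t ∈ S, OffCycle c t) (hT : ∀ t ∈ T, OffCycle c t) (hST : Disjoint S T)
    (hl : Linked G (c i) (c j) S) (hl' : Linked G (c k) (c l) T) (hik : i < k) (hkj : k ≤ j)
    (hjl : j < l) (hli : l ≤ i + m) : (S.card : ℤ) + T.card + 2 ≤ (k - i) + (l - j) := by
  rw [← h.periodic i] at hl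
  have d1 : Disjoint ((Finset.Icc k j).image c) ((Finset.Icc l (i + m)).image c) :=
    h.disjoint_segment hjl (by omega)
  have p := (h.hasPath_segment hkj (by omega)).append_linked hl.symm
    (h.hasPath_segment hli (by omega)).symm d1 (disjoint_segment_off hS _ _)
    (disjoint_segment_off hS _ _)
  have h1 := h.card_le_of_linked p hl'.symm (by
    simp only [Finset.disjoint_union_left]
    exact ⟨⟨disjoint_segment_off hT _ _, hST⟩, disjoint_segment_off hT _ _⟩)
  rw [Finset.card_union_of_disjoint, Finset.card_union_of_disjoint] at h1
  · have h2 := h.card_segment hli (by omega)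
    have h3 := h.card_segment hkj (by omega)
    omega
  · exact disjoint_segment_off hS _ _
  · exact Finset.disjoint_union_left.mpr ⟨d1, (disjoint_segment_off hS _ _).symm⟩

theorem double_crossing (h : IsMaxCycle G m c) {i j k l z z' : ℤ} {S T R : Finset V}
    (hS : ∀ t ∈ S, OffCycle c t) (hT : ∀ t ∈ T, OffCycle c t) (hR : ∀ t ∈ R, OffCycle c t)
    (hST : Disjoint S T) (hSR : Disjoint S R) (hTR : Disjoint T R)
    (hl : Linked G (c i) (c j) S) (hl' : Linked G (c k) (c z') T) (hl'' : Linked G (c z) (c l) R)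
    (hik : i < k) (hkz : k ≤ z) (hzz : z < z') (hzj : z' ≤ j) (hjl : j < l) (hli : l ≤ i + m) :
    (S.card : ℤ) + T.card + R.card + 3 ≤ (z' - z) + (k - i) + (l - j) := by
  rw [← h.periodic i] at hl
  have d1 : Disjoint ((Finset.Icc z' j).image c) ((Finset.Icc l (i + m)).image c) :=
    h.disjoint_segment hjl (by omega)
  have d2 : Disjoint ((Finset.Icc k z).image c) ((Finset.Icc l (i + m)).image c) :=
    h.disjoint_segment (by omega) (by omega)
  have d3 : Disjoint ((Finset.Icc k z).image c) ((Finset.Icc z' j).image c) :=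
    h.disjoint_segment (by omega) (by omega)
  have oS := fun a b => disjoint_segment_off hS a b
  have oR := fun a b => disjoint_segment_off hR a b
  have oT := fun a b => disjoint_segment_off hT a b
  have p := (h.hasPath_segment hzj (by omega)).append_linked hl.symm
    (h.hasPath_segment hli (by omega)).symm d1 (oS _ _) (oS _ _)
  have d4 : Disjoint ((Finset.Icc z' j).image c ∪ S ∪ (Finset.Icc l (i + m)).image c)
      ((Finset.Icc k z).image c) := by
    simp only [Finset.disjoint_union_left]
    exact ⟨⟨d3.symm, (oS _ _).symm⟩, d2.symm⟩
  have d5 : Disjoint ((Finset.Icc z' j).image c ∪ S ∪ (Finset.Icc l (i + m)).image c) R := by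
    simp only [Finset.disjoint_union_left]
    exact ⟨⟨oR _ _, hSR⟩, oR _ _⟩
  have q := p.append_linked hl''.symm (h.hasPath_segment hkz (by omega)).symm d4 d5 (oR _ _)
  have h1 := h.card_le_of_linked q hl' (by
    simp only [Finset.disjoint_union_left]
    exact ⟨⟨⟨⟨oT _ _, hST⟩, oT _ _⟩, hTR.symm⟩, oT _ _⟩)
  rw [Finset.card_union_of_disjoint, Finset.card_union_of_disjoint d5,
    Finset.card_union_of_disjoint, Finset.card_union_of_disjoint (oS _ _)] at h1
  · have h2 := h.card_segment hli (by omega)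
    have h3 := h.card_segment hkz (by omega)
    have h4 := h.card_segment hzj (by omega)
    omega
  · exact Finset.disjoint_union_left.mpr ⟨d1, (oS _ _).symm⟩
  · exact Finset.disjoint_union_left.mpr ⟨d4, (oR _ _).symm⟩

end IsMaxCycle

set_option linter.unusedSectionVars false

section Degree

variable [Fintype V] [DecidableEq V] {G : SimpleGraph V} {m : ℕ} {c : ℤ → V}

/-- The indices in `[k, k + m)` of the neighbours of `x` on the cycle traversed by `c`. -/
def nbrIdx (G : SimpleGraph V) (m : ℕ) (c : ℤ → V) (k : ℤ) (x : V) : Finset ℤ :=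
  (Finset.Ico k (k + m)).filter fun i => G.Adj x (c i)

/-- The neighbours of `x` off the cycle traversed by `c`. -/
def offNbrs (G : SimpleGraph V) (c : ℤ → V) (x : V) : Finset V :=
  Finset.univ.filter fun t => G.Adj x t ∧ OffCycle c t

theorem mem_nbrIdx {k i : ℤ} {x : V} :
    i ∈ nbrIdx G m c k x ↔ (k ≤ i ∧ i < k + m) ∧ G.Adj x (c i) := by
  simp [nbrIdx]

theorem mem_offNbrs {t x : V} : t ∈ offNbrs G c x ↔ G.Adj x t ∧ OffCycle c t := by
  simp [offNbrs]

namespace IsMaxCycle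

theorem injOn_Ico (h : IsMaxCycle G m c) (k : ℤ) : Set.InjOn c (Set.Ico k (k + m)) := by
  intro x hx y hy hxy
  simp only [Set.mem_Ico] at hx hy
  rcases lt_trichotomy x y with hlt | hlt | hlt
  · exact absurd hxy (h.ne hlt (by omega))
  · exact hlt
  · exact absurd hxy.symm (h.ne hlt (by omega))

theorem deg_eq (h : IsMaxCycle G m c) (k : ℤ) (x : V) :
    deg G x = (nbrIdx G m c k x).card + (offNbrs G c x).card := by
  have h1 : G.neighborSet x = (((nbrIdx G m c k x).image c ∪ offNbrs G c x : Finset V) : Set V) := by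
    ext t
    simp only [SimpleGraph.mem_neighborSet, Finset.coe_union, Finset.coe_image, Set.mem_union,
      Set.mem_image, Finset.mem_coe, mem_nbrIdx, mem_offNbrs]
    constructor
    · intro ht
      by_cases ho : OffCycle c t
      · exact .inr ⟨ht, ho⟩
      · simp only [OffCycle, not_forall, not_not] at ho
        obtain ⟨i, rfl⟩ := ho
        obtain ⟨j, h1, h2, h3, -⟩ := h.exists_eq_mem_Ico k i
        exact .inl ⟨j, ⟨⟨h1, h2⟩, h3 ▸ ht⟩, h3.symm⟩
    · rintro (⟨i, ⟨-, hi⟩, rfl⟩ | ⟨ht, -⟩)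
      · exact hi
      · exact ht
  rw [deg, h1, Set.ncard_coe_finset, Finset.card_union_of_disjoint, Finset.card_image_of_injOn]
  · refine (h.injOn_Ico k).mono fun i hi => ?_
    exact (mem_nbrIdx.mp hi).1
  · simp only [Finset.disjoint_left, Finset.mem_image]
    rintro _ ⟨i, -, rfl⟩ hi
    exact (mem_offNbrs.mp hi).2 i rfl

theorem card_add_le (h : IsMaxCycle G m c) {S : Finset V} (hS : ∀ t ∈ S, OffCycle c t) :
    S.card + m ≤ Fintype.card V := by
  have h1 : ((Finset.Ico (0 : ℤ) (0 + m)).image c).card = m := by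
    rw [Finset.card_image_of_injOn]
    · simp
    · simpa using h.injOn_Ico 0
  have h2 : Disjoint S ((Finset.Ico (0 : ℤ) (0 + m)).image c) := by
    rw [Finset.disjoint_right]
    simp only [Finset.mem_image]
    rintro _ ⟨i, -, rfl⟩ hi
    exact hS _ hi i rfl
  have h3 := Finset.card_le_univ (S ∪ (Finset.Ico (0 : ℤ) (0 + m)).image c)
  rw [Finset.card_union_of_disjoint h2] at h3
  omega

end IsMaxCycle

/-- Every independent triple of vertices has degree sum at least `n`. -/
def LargeDegreeSum (G : SimpleGraph V) : Prop :=
  ∀ x y z, x ≠ y → x ≠ z → y ≠ z → ¬ G.Adj x y → ¬ G.Adj x z → ¬ G.Adj y z →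
    Fintype.card V ≤ deg G x + deg G y + deg G z

omit [DecidableEq V] in
theorem LargeDegreeSum.of_sigma3 (h : Fintype.card V ≤ sigma3 G) : LargeDegreeSum G := by
  intro x y z hxy hxz hyz h1 h2 h3
  have hs : IsIndepTriple G {x, y, z} := by
    refine ⟨Finset.card_eq_three.mpr ⟨x, y, z, hxy, hxz, hyz, rfl⟩, ?_⟩
    have h1' : ¬ G.Adj y x := fun h => h1 h.symm
    have h2' : ¬ G.Adj z x := fun h => h2 h.symm
    have h3' : ¬ G.Adj z y := fun h => h3 h.symm
    simp only [Finset.mem_insert, Finset.mem_singleton]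
    rintro a (rfl | rfl | rfl) b (rfl | rfl | rfl) hab <;> first | assumption | exact absurd rfl hab
  rw [sigma3, if_pos ⟨_, hs⟩] at h
  refine h.trans (Nat.sInf_le ⟨_, hs, ?_⟩)
  rw [Finset.sum_insert (by simp [hxy, hxz]), Finset.sum_pair hyz, add_assoc]

/-- The vertex `u` off the cycle can replace the vertex `c 0`. -/
structure Replaceable (G : SimpleGraph V) (m : ℕ) (c : ℤ → V) (u : V) : Prop
    extends IsMaxCycle G m c where
  off : OffCycle c u
  adj_one : G.Adj u (c 1)
  adj_neg_one : G.Adj u (c (-1))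

/-- The cycle `c` with `c 0` replaced by `u`. -/
def replaceZero (m : ℕ) (c : ℤ → V) (u : V) (i : ℤ) : V := if (m : ℤ) ∣ i then u else c i

theorem replaceZero_of_not_dvd {u : V} {i : ℤ} (hi : ¬ (m : ℤ) ∣ i) : replaceZero m c u i = c i :=
  if_neg hi

theorem replaceZero_of_mem {u : V} {i : ℤ} (h0 : 0 < i) (hm : i < m) :
    replaceZero m c u i = c i :=
  replaceZero_of_not_dvd fun h => by have := Int.le_of_dvd h0 h; omega

theorem replaceZero_of_dvd {u : V} {i : ℤ} (hi : (m : ℤ) ∣ i) : replaceZero m c u i = u :=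
  if_pos hi

namespace Replaceable

variable {u : V}

theorem eq_zero_of_dvd (h : IsMaxCycle G m c) {i : ℤ} (hi : (m : ℤ) ∣ i) : c i = c 0 := by
  obtain ⟨j, h1, h2, h3, h4⟩ := h.exists_eq_mem_Ico 0 i
  have h5 : (m : ℤ) ∣ j := (dvd_sub_right hi).mp h4
  rw [h3, Int.eq_zero_of_dvd_of_nonneg_of_lt h1 (by omega) h5]

theorem apply_congr (h : IsMaxCycle G m c) {i j : ℤ} (hi : (m : ℤ) ∣ i - j) : c i = c j := by
  simpa using eq_zero_of_dvd (h.shift j) hi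

theorem reverse (h : Replaceable G m c u) : Replaceable G m (fun i => c (-i)) u where
  toIsMaxCycle := h.toIsMaxCycle.reverse
  off i := h.off (-i)
  adj_one := h.adj_neg_one
  adj_neg_one := by simpa using h.adj_one

theorem swap (h : Replaceable G m c u) : Replaceable G m (replaceZero m c u) (c 0) where
  three_le := h.three_le
  dvd_of_eq i j he := by
    unfold replaceZero at he
    split_ifs at he with hi hj hj
    · exact dvd_sub hi hj
    · exact absurd he (h.off j)
    · exact absurd he.symm (h.off i)
    · exact h.dvd_of_eq _ _ he
  periodic i := by simp [replaceZero, h.periodic]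
  adj i := by
    have h3 := h.three_le
    unfold replaceZero
    split_ifs with hi hj hj
    · have h1 : (m : ℤ) ∣ 1 := by simpa using dvd_sub hj hi
      have := Int.le_of_dvd one_pos h1
      omega
    · rw [apply_congr h.toIsMaxCycle (i := i + 1) (j := 1) (by simpa using hi)]
      exact h.adj_one
    · rw [apply_congr h.toIsMaxCycle (i := i) (j := -1) (by simpa using hj)]
      exact h.adj_neg_one.symm
    · exact h.adj i
  max := h.max
  off i := by
    unfold replaceZero
    split_ifs with hi
    · exact (h.off 0).symm
    · intro he
      have := h.dvd_of_eq _ _ he.symm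
      simp only [sub_zero] at this
      exact hi this
  adj_one := by
    have := h.three_le
    rw [replaceZero_of_mem one_pos (by omega)]
    simpa using (h.adj 0)
  adj_neg_one := by
    have := h.three_le
    rw [replaceZero_of_not_dvd]
    · simpa using (h.adj (-1)).symm
    · rw [dvd_neg]
      intro h1
      have := Int.le_of_dvd one_pos h1
      omega

theorem off_replaceZero {w : V} (hw : OffCycle c w) (hwu : w ≠ u) :
    OffCycle (replaceZero m c u) w := by
  intro i
  unfold replaceZero
  split_ifs
  · exact hwu
  · exact hw i

end Replaceable

namespace IsMaxCycle

omit [Fintype V] [DecidableEq V] in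
theorem _root_.Paper.card_add_card_add_card_le {P Q R Z : Finset ℤ} (p q r : ℤ)
    (hP : ∀ i ∈ P, i + p ∈ Z) (hQ : ∀ i ∈ Q, i + q ∈ Z) (hR : ∀ i ∈ R, i + r ∈ Z)
    (hPQ : ∀ i ∈ P, ∀ j ∈ Q, i + p ≠ j + q) (hPR : ∀ i ∈ P, ∀ j ∈ R, i + p ≠ j + r)
    (hQR : ∀ i ∈ Q, ∀ j ∈ R, i + q ≠ j + r) : P.card + Q.card + R.card ≤ Z.card := by
  have e : ∀ (S : Finset ℤ) (s : ℤ), S.card = (S.image (· + s)).card := fun S s =>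
    (Finset.card_image_of_injective _ (add_left_injective s)).symm
  rw [e P p, e Q q, e R r, ← Finset.card_union_of_disjoint, ← Finset.card_union_of_disjoint]
  · refine Finset.card_le_card ?_
    simp only [Finset.union_subset_iff, Finset.image_subset_iff]
    exact ⟨⟨hP, hQ⟩, hR⟩
  · simp only [Finset.disjoint_left, Finset.mem_union, Finset.mem_image, not_exists]
    rintro _ (⟨i, hi, rfl⟩ | ⟨i, hi, rfl⟩) j ⟨hj, he⟩
    · exact hPR i hi j hj he.symm
    · exact hQR i hi j hj he.symm
  · simp only [Finset.disjoint_left, Finset.mem_image, not_exists]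
    rintro _ ⟨i, hi, rfl⟩ j ⟨hj, he⟩
    exact hPQ i hi j hj he.symm

theorem card_add_card_add_card_add_le (h : IsMaxCycle G m c) {P Q R : Finset V}
    (hP : ∀ t ∈ P, OffCycle c t) (hQ : ∀ t ∈ Q, OffCycle c t) (hR : ∀ t ∈ R, OffCycle c t)
    (hPQ : ∀ t ∈ P, t ∉ Q) (hPR : ∀ t ∈ P, t ∉ R) (hQR : ∀ t ∈ Q, t ∉ R) :
    P.card + Q.card + R.card + m ≤ Fintype.card V := by
  rw [← Finset.card_union_of_disjoint (Finset.disjoint_left.mpr hPQ),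
    ← Finset.card_union_of_disjoint]
  · apply h.card_add_le
    simp only [Finset.mem_union]
    rintro t ((ht | ht) | ht)
    exacts [hP t ht, hQ t ht, hR t ht]
  · rw [Finset.disjoint_union_left]
    exact ⟨Finset.disjoint_left.mpr hPR, Finset.disjoint_left.mpr hQR⟩

variable {u : V}

omit [Fintype V] [DecidableEq V] in
theorem _root_.Paper.OffCycle.singleton {x : V} (hx : OffCycle c x) :
    ∀ t ∈ ({x} : Finset V), OffCycle c t := by
  simpa using hx

omit [Fintype V] in
theorem _root_.Paper.OffCycle.pair {x y : V} (hx : OffCycle c x) (hy : OffCycle c y) :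
    ∀ t ∈ ({x, y} : Finset V), OffCycle c t := by
  simp only [Finset.mem_insert, Finset.mem_singleton]
  rintro t (rfl | rfl) <;> assumption

omit [Fintype V] in
theorem _root_.Paper.OffCycle.triple {x y z : V} (hx : OffCycle c x) (hy : OffCycle c y)
    (hz : OffCycle c z) : ∀ t ∈ ({x} ∪ {y, z} : Finset V), OffCycle c t := by
  simp only [Finset.mem_union, Finset.mem_insert, Finset.mem_singleton]
  rintro t (rfl | rfl | rfl) <;> assumption

omit [Fintype V] in
/-- No vertex off the cycle has two consecutive neighbours on it. -/
theorem not_adj_succ (h : IsMaxCycle G m c) {x : V} (hx : OffCycle c x) {i : ℤ}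
    (h1 : G.Adj x (c i)) : ¬ G.Adj x (c (i + 1)) := by
  intro h2
  have := h.three_le
  have := h.detour hx.singleton (.one h1.symm h2) (by omega) (by omega)
  simp at this

omit [Fintype V] in
theorem not_adj_add_of_path_two (h : IsMaxCycle G m c) {x y : V} (hx : OffCycle c x)
    (hy : OffCycle c y) (hxy : G.Adj x y) {i j : ℤ} (h1 : G.Adj x (c i)) (hij : i < j)
    (hj : j ≤ i + 2) : ¬ G.Adj y (c j) := by
  intro h2
  have := h.three_le
  have := h.detour (hx.pair hy) (.two h1.symm hxy h2) hij (by omega)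
  rw [Finset.card_pair hxy.ne] at this
  push_cast at this
  omega

/-- A vertex with all neighbours on the cycle shares no cycle neighbour with an edge off it. -/
theorem not_adj_of_edge_off (h : IsMaxCycle G m c) (hσ : LargeDegreeSum G) (hu : OffCycle c u)
    (hU : ∀ w, G.Adj u w → ¬ OffCycle c w) {s y : V} (hs : OffCycle c s) (hy : OffCycle c y)
    (hsy : G.Adj s y) {i : ℤ} (hui : G.Adj u (c i)) : ¬ G.Adj s (c i) := by
  intro hsi
  wlog hi : i = 0 generalizing c i
  · refine this (h.shift i) (fun j => hu _) (fun w hw ho => hU w hw fun j => ?_) (fun j => hs _)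
      (fun j => hy _) (i := 0) (by simpa using hui) (by simpa using hsi) rfl
    simpa using ho (j - i)
  subst hi
  have h3 := h.three_le
  have hpm : c (m + 1) = c 1 := by rw [add_comm]; exact h.periodic 1
  have hp0 : c m = c 0 := by simpa using h.periodic 0
  have huy : u ≠ y := by
    rintro rfl
    exact hU s hsy.symm hs
  have f0 : ¬ G.Adj u (c 1) := h.not_adj_succ hu hui
  have f0' : ¬ G.Adj y (c 1) := h.not_adj_add_of_path_two hs hy hsy hsi (by omega) (by omega)
  have f1 : ∀ z : ℤ, 1 ≤ z → z ≤ m → G.Adj u (c z) → ¬ G.Adj (c 1) (c (z + 1)) := by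
    intro z hz hzm hz1 hz2
    rcases hzm.lt_or_eq with hlt | rfl
    · have := h.crossing (T := ∅) hu.singleton (by simp) (by simp) (.one hui.symm hz1)
        (.edge hz2) (by omega) hz (by omega) (by omega)
      simp at this
    · rw [hpm] at hz2
      exact hz2.ne rfl
  have f2 : ∀ z : ℤ, 1 ≤ z → z ≤ m → G.Adj y (c z) → ¬ G.Adj (c 1) (c (z + 1)) := by
    intro z hz hzm hz1 hz2
    rcases hzm.lt_or_eq with hlt | rfl
    · have := h.crossing (T := ∅) (hs.pair hy) (by simp) (by simp) (.two hsi.symm hsy hz1)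
        (.edge hz2) (by omega) hz (by omega) (by omega)
      rw [Finset.card_pair hsy.ne] at this
      simp at this
    · rw [hpm] at hz2
      exact hz2.ne rfl
  have f3 : ∀ z : ℤ, 1 ≤ z → z < m → G.Adj y (c z) → ¬ G.Adj (c 1) (c (z + 2)) := by
    intro z hz hzm hz1 hz2
    rcases (show z + 1 ≤ m by omega).lt_or_eq with hlt | he
    · have := h.crossing (T := ∅) (hs.pair hy) (by simp) (by simp) (.two hsi.symm hsy hz1)
        (.edge hz2) (by omega) hz (by omega) (by omega)
      rw [Finset.card_pair hsy.ne] at this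
      push_cast at this
      simp at this
    · refine h.not_adj_add_of_path_two hy hs hsy.symm hz1 (j := m) (by omega) (by omega) ?_
      rwa [hp0]
  have f4 : ∀ t ∈ offNbrs G c (c 1), t ∉ insert u (insert y (offNbrs G c y)) := by
    intro t ht
    obtain ⟨ht1, ht2⟩ := mem_offNbrs.mp ht
    simp only [Finset.mem_insert, mem_offNbrs]
    rintro (rfl | rfl | ⟨ht3, -⟩)
    · exact f0 ht1.symm
    · exact f0' ht1.symm
    · by_cases hts : t = s
      · subst hts
        exact h.not_adj_succ hs hsi ht1.symm
      · have := h.detour (hs.triple hy ht2) (.three hsi.symm hsy ht3 hts ht1.symm)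
          (by omega) (by omega)
        simp at this
  have hdeg := hσ u (c 1) y (hu 1) huy (hy 1).symm f0 (fun ha => hU y ha hy) (fun ha => f0' ha.symm)
  rw [h.deg_eq 1 u, h.deg_eq 2 (c 1), h.deg_eq 1 y] at hdeg
  have hu0 : (offNbrs G c u).card = 0 := by
    rw [Finset.card_eq_zero, Finset.eq_empty_iff_forall_notMem]
    intro t ht
    exact hU t (mem_offNbrs.mp ht).1 (mem_offNbrs.mp ht).2
  have hoff := h.card_add_card_add_card_add_le (P := offNbrs G c (c 1))
    (Q := insert u (insert y (offNbrs G c y))) (R := ∅) (fun t ht => (mem_offNbrs.mp ht).2)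
    (by
      simp only [Finset.mem_insert, mem_offNbrs]
      rintro t (rfl | rfl | ⟨-, ht⟩) <;> assumption) (by simp) f4 (by simp) (by simp)
  rw [Finset.card_insert_of_notMem, Finset.card_insert_of_notMem] at hoff
  rotate_left
  · simp [mem_offNbrs]
  · simp only [Finset.mem_insert, mem_offNbrs]
    rintro (ht | ⟨ht, -⟩)
    · exact huy ht
    · exact hU y ht.symm hy
  have hidx := card_add_card_add_card_le (P := nbrIdx G m c 2 (c 1))
    (Q := nbrIdx G m c 1 u ∪ nbrIdx G m c 1 y)
    (R := (nbrIdx G m c 1 u ∩ nbrIdx G m c 1 y).erase m) (Z := Finset.Icc 2 (m + 1)) 0 1 2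
    (by
      intro i hi
      rw [mem_nbrIdx] at hi
      rw [Finset.mem_Icc]
      omega)
    (by
      intro i hi
      rw [Finset.mem_union, mem_nbrIdx, mem_nbrIdx] at hi
      rw [Finset.mem_Icc]
      omega)
    (by
      intro i hi
      rw [Finset.mem_erase, Finset.mem_inter, mem_nbrIdx] at hi
      rw [Finset.mem_Icc]
      omega)
    (by
      intro i hi j hj hij
      obtain rfl : i = j + 1 := by omega
      rw [Finset.mem_union, mem_nbrIdx, mem_nbrIdx] at hj
      rw [mem_nbrIdx] at hi
      rcases hj with hj | hj
      · exact f1 j hj.1.1 (by omega) hj.2 hi.2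
      · exact f2 j hj.1.1 (by omega) hj.2 hi.2)
    (by
      intro i hi j hj hij
      obtain rfl : i = j + 2 := by omega
      rw [Finset.mem_erase, Finset.mem_inter, mem_nbrIdx, mem_nbrIdx] at hj
      rw [mem_nbrIdx] at hi
      exact f3 j hj.2.1.1.1 (by omega) hj.2.2.2 hi.2)
    (by
      intro i hi j hj hij
      obtain rfl : i = j + 1 := by omega
      rw [Finset.mem_erase, Finset.mem_inter, mem_nbrIdx, mem_nbrIdx] at hj
      rw [Finset.mem_union, mem_nbrIdx, mem_nbrIdx] at hi
      rcases hi with hi | hi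
      · exact h.not_adj_succ hu hj.2.1.2 hi.2
      · exact h.not_adj_succ hy hj.2.2.2 hi.2)
  have e1 := Finset.card_union_add_card_inter (nbrIdx G m c 1 u) (nbrIdx G m c 1 y)
  have e2 := Finset.pred_card_le_card_erase (s := nbrIdx G m c 1 u ∩ nbrIdx G m c 1 y)
    (a := (m : ℤ))
  simp only [Int.card_Icc, Finset.card_empty] at hidx hoff
  omega

/-- The successor of a neighbour of a vertex with all neighbours on the cycle has no other
neighbour off it. -/
theorem not_adj_off_of_adj (h : IsMaxCycle G m c) (hσ : LargeDegreeSum G) (hu : OffCycle c u)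
    (hU : ∀ w, G.Adj u w → ¬ OffCycle c w) {i j : ℤ} (hui : G.Adj u (c i)) (huj : G.Adj u (c j))
    (hij : c i ≠ c j) {w : V} (hw : OffCycle c w) (hwu : w ≠ u) : ¬ G.Adj w (c (i + 1)) := by
  intro hwi
  wlog hi : i = 0 generalizing c i j
  · refine this (h.shift i) (fun j => hu _) (fun w hw ho => hU w hw fun j => ?_)
      (i := 0) (j := j - i) (by simpa using hui) (by simpa using huj) (by simpa using hij)
      (fun j => hw _) (by simpa [add_comm] using hwi) rfl
    simpa using ho (j - i)
  subst hi
  have h3 := h.three_le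
  rw [zero_add] at hwi
  have hpm : c (m + 1) = c 1 := by rw [add_comm]; exact h.periodic 1
  have hp0 : c m = c 0 := by simpa using h.periodic 0
  obtain ⟨d, hd, hdmax⟩ : ∃ d ∈ (nbrIdx G m c 1 u).erase m, ∀ z ∈ (nbrIdx G m c 1 u).erase m,
      z ≤ d := by
    refine Finset.exists_max_image _ id ?_
    obtain ⟨j', h1, h2, h4, -⟩ := h.exists_eq_mem_Ico 1 j
    refine ⟨j', Finset.mem_erase.mpr ⟨?_, mem_nbrIdx.mpr ⟨⟨h1, h2⟩, h4 ▸ huj⟩⟩⟩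
    rintro rfl
    exact hij (by rw [h4, hp0])
  rw [Finset.mem_erase, mem_nbrIdx] at hd
  obtain ⟨hdm, ⟨hd1, hdm'⟩, hud⟩ := hd
  have hum : G.Adj u (c m) := hp0 ▸ hui
  have hdm1 : d + 1 < m := by
    by_contra! hcon
    obtain rfl : d = m - 1 := by omega
    exact h.not_adj_succ hu hud (by simpa using hum)
  replace hdmax : ∀ z : ℤ, d < z → z < m → ¬ G.Adj u (c z) := by
    intro z h1 h2 h4
    have := hdmax z (by
      rw [Finset.mem_erase, mem_nbrIdx]
      exact ⟨by omega, ⟨by omega, by omega⟩, h4⟩)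
    omega
  have huw : Disjoint ({u} : Finset V) {w} := by simpa using hwu.symm
  have hwu' : ¬ G.Adj w u := fun ha => hU w ha.symm hw
  -- a vertex adjacent to `u` followed on the cycle by one adjacent to `w`
  have f1 : ∀ z q : ℤ, 1 ≤ z → z < q → q ≤ z + 2 → q ≤ m → G.Adj u (c z) → ¬ G.Adj w (c q) := by
    intro z q hz hzq hqz hqm hz1 hz2
    have := h.crossing hu.singleton hw.singleton huw (.one hui.symm hz1) (.one hwi.symm hz2)
      (by omega) hz hzq (by omega)
    simp at this
    omega
  have f2 : ∀ z q : ℤ, 1 ≤ z → z < q → q ≤ z + 2 → q ≤ d → G.Adj w (c q) →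
      ¬ G.Adj (c (d + 1)) (c z) := by
    intro z q hz hzq hqz hqm hz1 hz2
    have := h.double_crossing (R := ∅) hu.singleton hw.singleton (by simp) huw (by simp)
      (by simp) (.one hui.symm hud) (.one hwi.symm hz1) (.edge hz2.symm)
      (by omega) hz hzq hqm (by omega) (by omega)
    simp at this
    omega
  have f3 : ∀ z : ℤ, 0 ≤ z → z < d → G.Adj u (c z) → ¬ G.Adj (c (d + 1)) (c (z + 1)) := by
    intro z hz hzd hz1 hz2
    have := h.crossing (T := ∅) hu.singleton (by simp) (by simp) (.one hz1.symm hud)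
      (.edge hz2.symm) (by omega) (by omega) (by omega) (by omega)
    simp at this
  have f4 : ∀ z : ℤ, d + 1 ≤ z → z < m → G.Adj w (c z) → ¬ G.Adj (c (d + 1)) (c (z + 1)) := by
    intro z hz hzd hz1 hz2
    have := h.double_crossing (T := ∅) hu.singleton (by simp) hw.singleton (by simp) huw
      (by simp) (.one hud.symm hum) (.edge hz2) (.one hz1.symm (hpm ▸ hwi))
      (by omega) hz (by omega) (by omega) (by omega) (by omega)
    simp at this
  have f5 : ¬ G.Adj w (c m) := fun ha => h.not_adj_succ hw ha (hpm ▸ hwi)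
  have f6 : ¬ G.Adj w (c 2) := h.not_adj_succ hw hwi
  have f7 : ¬ G.Adj w (c (d + 1)) := f1 d (d + 1) hd1 (by omega) (by omega) (by omega) hud
  have f8 : ¬ G.Adj w (c (d + 2)) := by
    exact f1 d (d + 2) hd1 (by omega) (by omega) (by omega) hud
  have f9 : ¬ G.Adj u (c (d + 1)) := h.not_adj_succ hu hud
  have f10 : ∀ t ∈ offNbrs G c (c (d + 1)), t ∉ insert u (insert w (offNbrs G c w)) := by
    intro t ht
    obtain ⟨ht1, ht2⟩ := mem_offNbrs.mp ht
    simp only [Finset.mem_insert, mem_offNbrs]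
    rintro (rfl | rfl | ⟨ht3, -⟩)
    · exact f9 ht1.symm
    · exact f7 ht1.symm
    · have := h.crossing hu.singleton (hw.pair ht2) (by
          have : u ≠ t := by
            rintro rfl
            exact hwu' ht3
          simpa using ⟨hwu.symm, this⟩) (.one hui.symm hud) (.two hwi.symm ht3 ht1.symm)
        (by omega) hd1 (by omega) (by omega)
      rw [Finset.card_pair ht3.ne] at this
      simp at this
  have hdeg := hσ u (c (d + 1)) w (hu _) hwu.symm (hw _).symm f9 (fun ha => hwu' ha.symm)
    (fun ha => f7 ha.symm)
  rw [h.deg_eq 1 u, h.deg_eq 1 (c (d + 1)), h.deg_eq 1 w] at hdeg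
  have hu0 : (offNbrs G c u).card = 0 := by
    rw [Finset.card_eq_zero, Finset.eq_empty_iff_forall_notMem]
    intro t ht
    exact hU t (mem_offNbrs.mp ht).1 (mem_offNbrs.mp ht).2
  have hoff := h.card_add_card_add_card_add_le (P := offNbrs G c (c (d + 1)))
    (Q := insert u (insert w (offNbrs G c w))) (R := ∅) (fun t ht => (mem_offNbrs.mp ht).2)
    (by
      simp only [Finset.mem_insert, mem_offNbrs]
      rintro t (rfl | rfl | ⟨-, ht⟩) <;> assumption) (by simp) f10 (by simp) (by simp)
  rw [Finset.card_insert_of_notMem, Finset.card_insert_of_notMem] at hoff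
  rotate_left
  · simp [mem_offNbrs]
  · simp only [Finset.mem_insert, mem_offNbrs]
    rintro (ht | ⟨ht, -⟩)
    · exact hwu ht.symm
    · exact hwu' ht
  have split : ∀ x, (nbrIdx G m c 1 x).card = ((nbrIdx G m c 1 x).filter (· ≤ d)).card +
      ((nbrIdx G m c 1 x).filter (¬ · ≤ d)).card := fun x =>
    (Finset.card_filter_add_card_filter_not _).symm
  have hlow := card_add_card_add_card_le
    (P := (nbrIdx G m c 1 (c (d + 1))).filter (· ≤ d)) (Q := (nbrIdx G m c 1 u).filter (· ≤ d))
    (R := (nbrIdx G m c 1 w).filter (· ≤ d)) (Z := (Finset.Icc 1 (d + 2)).erase 2) 1 2 0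
    (by
      intro i hi
      rw [Finset.mem_filter, mem_nbrIdx] at hi
      rw [Finset.mem_erase, Finset.mem_Icc]
      refine ⟨fun he => ?_, by omega, by omega⟩
      obtain rfl : i = 1 := by omega
      exact f3 0 le_rfl (by omega) hui hi.1.2)
    (by
      intro i hi
      rw [Finset.mem_filter, mem_nbrIdx] at hi
      rw [Finset.mem_erase, Finset.mem_Icc]
      omega)
    (by
      intro i hi
      rw [Finset.mem_filter, mem_nbrIdx] at hi
      rw [Finset.mem_erase, Finset.mem_Icc]
      refine ⟨fun he => ?_, by omega, by omega⟩
      obtain rfl : i = 2 := by omega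
      exact f6 hi.1.2)
    (by
      intro i hi j hj hij
      obtain rfl : i = j + 1 := by omega
      rw [Finset.mem_filter, mem_nbrIdx] at hi hj
      exact f3 j (by omega) (by omega) hj.1.2 hi.1.2)
    (by
      intro i hi j hj hij
      rw [Finset.mem_filter, mem_nbrIdx] at hi hj
      exact f2 i j (by omega) (by omega) (by omega) (by omega) hj.1.2 hi.1.2)
    (by
      intro i hi j hj hij
      rw [Finset.mem_filter, mem_nbrIdx] at hi hj
      exact f1 i j (by omega) (by omega) (by omega) (by omega) hi.1.2 hj.1.2)
  have hhigh := card_add_card_add_card_le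
    (P := (nbrIdx G m c 1 (c (d + 1))).filter (¬ · ≤ d))
    (Q := (nbrIdx G m c 1 w).filter (¬ · ≤ d)) (R := ∅) (Z := Finset.Icc (d + 2) m) 0 1 0
    (by
      intro i hi
      rw [Finset.mem_filter, mem_nbrIdx] at hi
      rw [Finset.mem_Icc]
      refine ⟨?_, by omega⟩
      by_contra! hcon
      obtain rfl : i = d + 1 := by omega
      exact hi.1.2.ne rfl)
    (by
      intro i hi
      rw [Finset.mem_filter, mem_nbrIdx] at hi
      rw [Finset.mem_Icc]
      refine ⟨by omega, ?_⟩
      by_contra! hcon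
      obtain rfl : i = m := by omega
      exact f5 hi.1.2)
    (by simp)
    (by
      intro i hi j hj hij
      obtain rfl : i = j + 1 := by omega
      rw [Finset.mem_filter, mem_nbrIdx] at hi hj
      exact f4 j (by omega) (by omega) hj.1.2 hi.1.2)
    (by simp) (by simp)
  have hu1 : ((nbrIdx G m c 1 u).filter (¬ · ≤ d)).card ≤ 1 := by
    rw [← Finset.card_singleton (m : ℤ)]
    refine Finset.card_le_card fun i hi => ?_
    rw [Finset.mem_filter, mem_nbrIdx] at hi
    rw [Finset.mem_singleton]
    by_contra hcon
    exact hdmax i (by omega) (by omega) hi.1.2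
  rw [Finset.card_erase_of_mem (Finset.mem_Icc.mpr ⟨by omega, by omega⟩)] at hlow
  rw [split u, split w, split (c (d + 1))] at hdeg
  simp only [Int.card_Icc, Finset.card_empty] at hlow hhigh hoff
  omega

end IsMaxCycle

namespace Replaceable

variable {u : V}

theorem not_adj_zero (h : Replaceable G m c u) : ¬ G.Adj u (c 0) := by
  simpa using h.not_adj_succ h.off h.adj_neg_one

theorem not_off_of_adj (h : Replaceable G m c u) (hσ : LargeDegreeSum G) {w : V}
    (huw : G.Adj u w) : ¬ OffCycle c w := by
  intro hw
  have hc := h.toIsMaxCycle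
  have h3 := h.three_le
  have hu := h.off
  have hp1 : c (m + 1) = c 1 := by rw [add_comm]; exact hc.periodic 1
  have hp0 : c m = c 0 := by simpa using hc.periodic 0
  have hpn : c (m - 1) = c (-1) := by
    rw [← hc.periodic (-1)]
    congr 1
  have hu0 := h.not_adj_zero
  have hum : G.Adj u (c (m - 1)) := hpn ▸ h.adj_neg_one
  have f0 : ¬ G.Adj w (c 0) :=
    hc.not_adj_add_of_path_two hu hw huw h.adj_neg_one (by omega) (by omega)
  have f1 : ¬ G.Adj w (c 1) :=
    hc.not_adj_add_of_path_two hu hw huw h.adj_neg_one (by omega) (by omega)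
  have f2 : ¬ G.Adj w (c 2) :=
    hc.not_adj_add_of_path_two hu hw huw h.adj_one (by omega) (by omega)
  have f3 : ¬ G.Adj w (c 3) :=
    hc.not_adj_add_of_path_two hu hw huw h.adj_one (by omega) (by omega)
  have f4 : ¬ G.Adj w (c (m - 1)) := fun ha =>
    hc.not_adj_add_of_path_two hw hu huw.symm ha (j := m + 1) (by omega) (by omega)
      (hp1 ▸ h.adj_one)
  have f5 : ¬ G.Adj w (c (m - 2)) := fun ha =>
    hc.not_adj_add_of_path_two hw hu huw.symm ha (by omega) (by omega) hum
  have f6 : ¬ G.Adj u (c 2) := hc.not_adj_succ hu h.adj_one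
  have hrange : ∀ i : ℤ, 1 ≤ i → i < 1 + m → G.Adj w (c i) → 4 ≤ i ∧ i + 3 ≤ m := by
    intro i hi1 him hi
    have g1 : i ≠ 1 := fun he => f1 (he ▸ hi)
    have g2 : i ≠ 2 := fun he => f2 (he ▸ hi)
    have g3 : i ≠ 3 := fun he => f3 (he ▸ hi)
    have g4 : i ≠ m := fun he => f0 (hp0 ▸ he ▸ hi)
    have g5 : i ≠ m - 1 := fun he => f4 (he ▸ hi)
    have g6 : i ≠ m - 2 := fun he => f5 (he ▸ hi)
    omega
  have k0 : ¬ G.Adj (c 0) (c 2) := by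
    intro ha
    have := hc.crossing (T := ∅) hu.singleton (by simp) (by simp)
      (.one h.adj_neg_one.symm h.adj_one) (.edge ha) (by omega) (by omega) (by omega) (by omega)
    simp at this
  have k1 : ∀ z : ℤ, 2 ≤ z → z + 1 < m → G.Adj (c 0) (c z) → ¬ G.Adj (c 2) (c (z + 1)) := by
    intro z hz hzm h1 h2
    have := hc.double_crossing (T := ∅) (R := ∅) hu.singleton (by simp) (by simp) (by simp)
      (by simp) (by simp) (.one h.adj_one.symm hum) (.edge h2) (.edge (hp0 ▸ h1.symm))
      (by omega) hz (by omega) (by omega) (by omega) (by omega)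
    simp at this
  have k2 : ∀ z : ℤ, 4 ≤ z → z + 3 ≤ m → G.Adj w (c z) → ¬ G.Adj (c 2) (c (z + 2)) := by
    intro z hz hzm h1 h2
    have := hc.crossing (T := ∅) (hu.pair hw) (by simp) (by simp) (.two h.adj_one.symm huw h1)
      (.edge h2) (by omega) (by omega) (by omega) (by omega)
    rw [Finset.card_pair huw.ne] at this
    simp at this
  have k3 : ∀ z : ℤ, 4 ≤ z → z + 3 ≤ m → G.Adj w (c z) → ¬ G.Adj (c 0) (c (z + 1)) := by
    intro z hz hzm h1 h2
    have := hc.crossing (T := ∅) (hu.pair hw) (by simp) (by simp)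
      (.two h.adj_neg_one.symm huw h1) (.edge h2) (by omega) (by omega) (by omega) (by omega)
    rw [Finset.card_pair huw.ne] at this
    simp at this
  have o0 : ∀ t ∈ offNbrs G c (c 0), t ∉ insert w (offNbrs G c w) := by
    intro t ht
    obtain ⟨ht1, ht2⟩ := mem_offNbrs.mp ht
    simp only [Finset.mem_insert, mem_offNbrs]
    rintro (rfl | ⟨ht3, -⟩)
    · exact f0 ht1.symm
    · have htu : t ≠ u := fun he => hu0 (he ▸ ht1.symm)
      have := hc.detour (hu.triple hw ht2)
        (.three h.adj_neg_one.symm huw ht3 htu ht1.symm) (by omega) (by omega)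
      simp at this
  have o2 : ∀ t ∈ offNbrs G c (c 2), t ∉ insert w (offNbrs G c w) := by
    intro t ht
    obtain ⟨ht1, ht2⟩ := mem_offNbrs.mp ht
    simp only [Finset.mem_insert, mem_offNbrs]
    rintro (rfl | ⟨ht3, -⟩)
    · exact f2 ht1.symm
    · have htu : t ≠ u := fun he => f6 (he ▸ ht1.symm)
      have := hc.detour (hu.triple hw ht2)
        (.three h.adj_one.symm huw ht3 htu ht1.symm) (by omega) (by omega)
      simp at this
  have o02 : ∀ t ∈ offNbrs G c (c 0), t ∉ offNbrs G c (c 2) := by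
    intro t ht ht'
    obtain ⟨ht1, ht2⟩ := mem_offNbrs.mp ht
    obtain ⟨ht3, -⟩ := mem_offNbrs.mp ht'
    have htu : u ≠ t := fun he => hu0 (he ▸ ht1.symm)
    have := hc.crossing hu.singleton ht2.singleton (by simpa using htu)
      (.one h.adj_neg_one.symm h.adj_one) (.one ht1 ht3.symm) (by omega) (by omega) (by omega)
      (by omega)
    simp at this
  have hoff := hc.card_add_card_add_card_add_le (P := offNbrs G c (c 0)) (Q := offNbrs G c (c 2))
    (R := insert w (offNbrs G c w)) (fun t ht => (mem_offNbrs.mp ht).2)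
    (fun t ht => (mem_offNbrs.mp ht).2)
    (by
      simp only [Finset.mem_insert, mem_offNbrs]
      rintro t (rfl | ⟨-, ht⟩) <;> assumption) o02 o0 o2
  rw [Finset.card_insert_of_notMem (by simp [mem_offNbrs])] at hoff
  have hidx := card_add_card_add_card_le (P := (nbrIdx G m c 1 (c 0)).erase 1)
    (Q := (nbrIdx G m c 1 (c 2)).erase 1) (R := nbrIdx G m c 1 w) (Z := Finset.Icc 2 (m - 1))
    0 (-1) 1
    (by
      intro i hi
      rw [Finset.mem_erase, mem_nbrIdx] at hi
      rw [Finset.mem_Icc]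
      have : i ≠ m := by
        rintro rfl
        exact hi.2.2.ne hp0.symm
      omega)
    (by
      intro i hi
      rw [Finset.mem_erase, mem_nbrIdx] at hi
      rw [Finset.mem_Icc]
      have : i ≠ 2 := by
        rintro rfl
        exact hi.2.2.ne rfl
      omega)
    (by
      intro i hi
      rw [mem_nbrIdx] at hi
      rw [Finset.mem_Icc]
      have := hrange i hi.1.1 hi.1.2 hi.2
      omega)
    (by
      intro i hi j hj hij
      obtain rfl : j = i + 1 := by omega
      rw [Finset.mem_erase, mem_nbrIdx] at hi hj
      rcases (show i + 1 ≤ m by omega).lt_or_eq with hlt | he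
      · exact k1 i (by omega) hlt hi.2.2 hj.2.2
      · rw [he, hp0] at hj
        exact k0 hj.2.2.symm)
    (by
      intro i hi j hj hij
      obtain rfl : i = j + 1 := by omega
      rw [Finset.mem_erase, mem_nbrIdx] at hi
      rw [mem_nbrIdx] at hj
      obtain ⟨g1, g2⟩ := hrange j hj.1.1 hj.1.2 hj.2
      exact k3 j g1 g2 hj.2 hi.2.2)
    (by
      intro i hi j hj hij
      obtain rfl : i = j + 2 := by omega
      rw [Finset.mem_erase, mem_nbrIdx] at hi
      rw [mem_nbrIdx] at hj
      obtain ⟨g1, g2⟩ := hrange j hj.1.1 hj.1.2 hj.2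
      exact k2 j g1 g2 hj.2 hi.2.2)
  have hdeg := hσ (c 0) (c 2) w (hc.ne (by omega) (by
      by_contra! hm
      obtain rfl : m = 2 := by omega
      omega)) (hw 0).symm (hw 2).symm k0 (fun ha => f0 ha.symm) (fun ha => f2 ha.symm)
  rw [hc.deg_eq 1, hc.deg_eq 1 (c 2), hc.deg_eq 1 w] at hdeg
  have e1 := Finset.pred_card_le_card_erase (s := nbrIdx G m c 1 (c 0)) (a := 1)
  have e2 := Finset.pred_card_le_card_erase (s := nbrIdx G m c 1 (c 2)) (a := 1)
  simp only [Int.card_Icc] at hidx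
  omega

theorem not_off_of_adj_zero (h : Replaceable G m c u) (hσ : LargeDegreeSum G) {w : V}
    (hw : G.Adj (c 0) w) : ¬ OffCycle c w := fun ho =>
  h.swap.not_off_of_adj hσ hw
    (off_replaceZero ho (by rintro rfl; exact h.not_adj_zero hw.symm))

theorem not_adj_off (h : Replaceable G m c u) (hσ : LargeDegreeSum G) {i : ℤ}
    (hui : G.Adj u (c i)) {w : V} (hw : OffCycle c w) (hwu : w ≠ u) : ¬ G.Adj w (c (i + 1)) := by
  have hne : c (-1) ≠ c 1 := h.ne (by omega) (by have := h.three_le; omega)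
  by_cases hi : c i = c 1
  · exact h.not_adj_off_of_adj hσ h.off (fun _ => h.not_off_of_adj hσ) hui h.adj_neg_one
      (hi ▸ hne.symm) hw hwu
  · exact h.not_adj_off_of_adj hσ h.off (fun _ => h.not_off_of_adj hσ) hui h.adj_one hi hw hwu

theorem not_adj_off' (h : Replaceable G m c u) (hσ : LargeDegreeSum G) {i : ℤ} (hi0 : 0 < i)
    (him : i < m) (hi : G.Adj (c 0) (c i)) {w : V} (hw : OffCycle c w) (hwu : w ≠ u) :
    ¬ G.Adj w (c (i + 1)) := by
  rcases (show i + 1 ≤ m by omega).lt_or_eq with hlt | he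
  · have := h.swap.not_adj_off hσ (i := i) (by rwa [replaceZero_of_mem hi0 him])
      (off_replaceZero hw hwu) (hw 0)
    rwa [replaceZero_of_mem (by omega) hlt] at this
  · rw [he, show c m = c 0 by simpa using h.periodic 0]
    exact fun ha => h.not_off_of_adj_zero hσ ha.symm hw

theorem not_adj_zero_succ (h : Replaceable G m c u) {i : ℤ} (hi0 : 0 < i) (him : i + 1 < m)
    (hi : G.Adj u (c i)) : ¬ G.Adj (c 0) (c (i + 1)) := by
  intro ha
  have hpn : c (m - 1) = c (-1) := by
    rw [← h.periodic (-1)]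
    congr 1
  have hp0 : c m = c 0 := by simpa using h.periodic 0
  have := h.crossing (T := ∅) h.off.singleton (by simp) (by simp)
    (.one hi.symm (hpn ▸ h.adj_neg_one)) (.edge (hp0 ▸ ha.symm)) (by omega) (by omega) (by omega)
    (by omega)
  simp at this

theorem not_adj_succ_of_adj_zero (h : Replaceable G m c u) {i : ℤ} (hi0 : 0 < i) (him : i + 1 < m)
    (hi : G.Adj (c 0) (c i)) : ¬ G.Adj u (c (i + 1)) := by
  have := h.swap.not_adj_zero_succ hi0 him (by rwa [replaceZero_of_mem hi0 (by omega)])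
  rwa [replaceZero_of_mem (by omega) him, replaceZero_of_dvd (dvd_zero _)] at this

theorem not_adj_off_off (h : Replaceable G m c u) (hσ : LargeDegreeSum G) {w y : V}
    (hw : OffCycle c w) (hy : OffCycle c y) : ¬ G.Adj w y := by
  intro hwy
  have h3 := h.three_le
  have hc := h.toIsMaxCycle
  have hp0 : c m = c 0 := by simpa using h.periodic 0
  have hwu : w ≠ u := by rintro rfl; exact h.not_off_of_adj hσ hwy hy
  have hyu : y ≠ u := by rintro rfl; exact h.not_off_of_adj hσ hwy.symm hw
  have huw : ¬ G.Adj u w := fun ha => h.not_off_of_adj hσ ha hw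
  have h0w : ¬ G.Adj (c 0) w := fun ha => h.not_off_of_adj_zero hσ ha hw
  have hB : ∀ i ∈ nbrIdx G m c 1 u ∪ nbrIdx G m c 1 (c 0),
      0 < i ∧ i < m ∧ (G.Adj u (c i) ∨ G.Adj (c 0) (c i)) := by
    intro i hi
    rw [Finset.mem_union, mem_nbrIdx, mem_nbrIdx] at hi
    have : i ≠ m := by
      rintro rfl
      rw [hp0] at hi
      rcases hi with hi | hi
      · exact h.not_adj_zero hi.2
      · exact hi.2.ne rfl
    exact ⟨by omega, by omega, hi.imp And.right And.right⟩
  have hidx := card_add_card_add_card_le (P := nbrIdx G m c 1 u ∪ nbrIdx G m c 1 (c 0))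
    (Q := nbrIdx G m c 1 u ∪ nbrIdx G m c 1 (c 0)) (R := nbrIdx G m c 1 w)
    (Z := Finset.Icc 1 m) 0 1 0
    (by
      intro i hi
      have := hB i hi
      rw [Finset.mem_Icc]
      omega)
    (by
      intro i hi
      have := hB i hi
      rw [Finset.mem_Icc]
      omega)
    (by
      intro i hi
      rw [mem_nbrIdx] at hi
      rw [Finset.mem_Icc]
      omega)
    (by
      intro i hi j hj hij
      obtain rfl : i = j + 1 := by omega
      obtain ⟨-, hi2, hi⟩ := hB _ hi
      obtain ⟨hj1, -, hj⟩ := hB _ hj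
      rcases hi with hi | hi <;> rcases hj with hj | hj
      · exact hc.not_adj_succ h.off hj hi
      · exact h.not_adj_succ_of_adj_zero hj1 hi2 hj hi
      · exact h.not_adj_zero_succ hj1 hi2 hj hi
      · refine h.swap.not_adj_succ h.swap.off (i := j) ?_ ?_
        · rwa [replaceZero_of_mem hj1 (by omega)]
        · rwa [replaceZero_of_mem (by omega) hi2])
    (by
      intro i hi j hj hij
      obtain rfl : i = j := by omega
      obtain ⟨hi1, hi2, hi⟩ := hB _ hi
      rw [mem_nbrIdx] at hj
      rcases hi with hi | hi
      · exact hc.not_adj_of_edge_off hσ h.off (fun _ => h.not_off_of_adj hσ) hw hy hwy hi hj.2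
      · refine h.swap.not_adj_of_edge_off hσ h.swap.off (fun _ => h.swap.not_off_of_adj hσ)
          (off_replaceZero hw hwu) (off_replaceZero hy hyu) hwy (i := i) ?_ ?_
        · rwa [replaceZero_of_mem hi1 hi2]
        · rw [replaceZero_of_mem hi1 hi2]
          exact hj.2)
    (by
      intro i hi j hj hij
      obtain rfl : j = i + 1 := by omega
      obtain ⟨hi1, hi2, hi⟩ := hB _ hi
      rw [mem_nbrIdx] at hj
      rcases hi with hi | hi
      · exact h.not_adj_off hσ hi hw hwu hj.2
      · exact h.not_adj_off' hσ hi1 hi2 hi hw hwu hj.2)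
  have hdeg := hσ u (c 0) w (h.off 0) hwu.symm (hw 0).symm h.not_adj_zero huw h0w
  rw [hc.deg_eq 1 u, hc.deg_eq 1 (c 0), hc.deg_eq 1 w] at hdeg
  have hu0 : (offNbrs G c u).card = 0 := by
    rw [Finset.card_eq_zero, Finset.eq_empty_iff_forall_notMem]
    intro t ht
    exact h.not_off_of_adj hσ (mem_offNbrs.mp ht).1 (mem_offNbrs.mp ht).2
  have h00 : (offNbrs G c (c 0)).card = 0 := by
    rw [Finset.card_eq_zero, Finset.eq_empty_iff_forall_notMem]
    intro t ht
    exact h.not_off_of_adj_zero hσ (mem_offNbrs.mp ht).1 (mem_offNbrs.mp ht).2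
  have hoff := hc.card_add_le (S := insert w (offNbrs G c w)) (by
    simp only [Finset.mem_insert, mem_offNbrs]
    rintro t (rfl | ⟨-, ht⟩) <;> assumption)
  rw [Finset.card_insert_of_notMem (by simp [mem_offNbrs])] at hoff
  have e1 := Finset.card_le_card (Finset.subset_union_left (s₁ := nbrIdx G m c 1 u)
    (s₂ := nbrIdx G m c 1 (c 0)))
  have e2 := Finset.card_le_card (Finset.subset_union_right (s₁ := nbrIdx G m c 1 u)
    (s₂ := nbrIdx G m c 1 (c 0)))
  simp only [Int.card_Icc] at hidx
  omega

theorem not_adj_succ_succ_of_adj (h : Replaceable G m c u) {i j : ℤ} (hi : G.Adj u (c i))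
    (hj : G.Adj u (c j)) (hi0 : 0 < i) (hij : i < j) (hjm : j < m) :
    ¬ G.Adj (c (i + 1)) (c (j + 1)) := by
  intro ha
  have := h.crossing (T := ∅) h.off.singleton (by simp) (by simp) (.one hi.symm hj) (.edge ha)
    (by omega) (by omega) (by omega) (by omega)
  simp at this

theorem not_adj_succ_succ_of_adj_of_adj_zero (h : Replaceable G m c u) {i j : ℤ}
    (hi : G.Adj u (c i)) (hj : G.Adj (c 0) (c j)) (hi0 : 0 < i) (hij : i < j) (hjm : j + 1 < m) :
    ¬ G.Adj (c (i + 1)) (c (j + 1)) := by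
  intro ha
  have hpn : c (m - 1) = c (-1) := by
    rw [← h.periodic (-1)]
    congr 1
  have hp0 : c m = c 0 := by simpa using h.periodic 0
  have := h.double_crossing (T := ∅) (R := ∅) h.off.singleton (by simp) (by simp) (by simp)
    (by simp) (by simp) (.one hi.symm (hpn ▸ h.adj_neg_one)) (.edge ha) (.edge (hp0 ▸ hj.symm))
    (by omega) (by omega) (by omega) (by omega) (by omega) (by omega)
  simp at this

theorem not_adj_succ_succ (h : Replaceable G m c u) {i j : ℤ}
    (hi : G.Adj u (c i) ∨ G.Adj (c 0) (c i)) (hj : G.Adj u (c j) ∨ G.Adj (c 0) (c j))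
    (hi0 : 0 < i) (hij : i < j) (hjm : j < m) : ¬ G.Adj (c (i + 1)) (c (j + 1)) := by
  have hs : ∀ z : ℤ, 0 < z → z < m → replaceZero m c u z = c z := fun z => replaceZero_of_mem
  have hs0 : replaceZero m c u 0 = u := replaceZero_of_dvd (dvd_zero _)
  rcases (show j + 1 ≤ m by omega).lt_or_eq with hlt | he
  · rcases hi with hi | hi <;> rcases hj with hj | hj
    · exact h.not_adj_succ_succ_of_adj hi hj hi0 hij hjm
    · exact h.not_adj_succ_succ_of_adj_of_adj_zero hi hj hi0 hij hlt
    · have := h.swap.not_adj_succ_succ_of_adj_of_adj_zero (i := i) (j := j)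
        (by rwa [hs _ hi0 (by omega)]) (by rwa [hs0, hs _ (by omega) hjm]) hi0 hij hlt
      rwa [hs _ (by omega) (by omega), hs _ (by omega) hlt] at this
    · have := h.swap.not_adj_succ_succ_of_adj (i := i) (j := j)
        (by rwa [hs _ hi0 (by omega)]) (by rwa [hs _ (by omega) hjm]) hi0 hij hjm
      rwa [hs _ (by omega) (by omega), hs _ (by omega) hlt] at this
  · obtain rfl : j = m - 1 := by omega
    have huj : G.Adj u (c (m - 1)) := by
      rw [show c (m - 1) = c (-1) by rw [← h.periodic (-1)]; congr 1]
      exact h.adj_neg_one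
    rcases hi with hi | hi
    · exact h.not_adj_succ_succ_of_adj hi huj hi0 hij hjm
    · rw [he, show c m = c 0 by simpa using h.periodic 0]
      intro ha
      refine h.swap.not_adj_succ h.swap.off (i := i) ?_ ?_
      · rwa [hs _ hi0 (by omega)]
      · rw [hs _ (by omega) (by omega)]
        exact ha.symm

theorem succ_not_adj_off (h : Replaceable G m c u) (hσ : LargeDegreeSum G) {i : ℤ}
    (hi : G.Adj u (c i) ∨ G.Adj (c 0) (c i)) (hi0 : 0 < i) (him : i < m) {w : V}
    (hw : OffCycle c w) : ¬ G.Adj w (c (i + 1)) := by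
  by_cases hwu : w = u
  · subst hwu
    rcases hi with hi | hi
    · exact h.not_adj_succ hw hi
    · rcases (show i + 1 ≤ m by omega).lt_or_eq with hlt | he
      · exact h.not_adj_succ_of_adj_zero hi0 hlt hi
      · rw [he, show c m = c 0 by simpa using h.periodic 0]
        exact h.not_adj_zero
  · rcases hi with hi | hi
    · exact h.not_adj_off hσ hi hw hwu
    · exact h.not_adj_off' hσ hi0 him hi hw hwu

theorem isIndepSet_image_succ (h : Replaceable G m c u) (hσ : LargeDegreeSum G) (f : V → V)
    (hf : ∀ i, f (c i) = c (i + 1)) :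
    IsIndepSet G (f '' (G.neighborSet u ∪ G.neighborSet (c 0)) ∪ {x | OffCycle c x}) := by
  have key : ∀ x ∈ f '' (G.neighborSet u ∪ G.neighborSet (c 0)), ∃ i : ℤ, 0 < i ∧ i < m ∧
      (G.Adj u (c i) ∨ G.Adj (c 0) (c i)) ∧ x = c (i + 1) := by
    rintro _ ⟨b, hb, rfl⟩
    have hb' : G.Adj u b ∨ G.Adj (c 0) b := hb
    have hon : ¬ OffCycle c b :=
      hb'.elim (fun ha => h.not_off_of_adj hσ ha) fun ha => h.not_off_of_adj_zero hσ ha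
    simp only [OffCycle, not_forall, not_not] at hon
    obtain ⟨j, rfl⟩ := hon
    obtain ⟨i, h1, h2, h3, -⟩ := h.exists_eq_mem_Ico 0 j
    rw [h3] at hb' ⊢
    refine ⟨i, lt_of_le_of_ne h1 ?_, by omega, hb', hf i⟩
    rintro rfl
    exact hb'.elim h.not_adj_zero fun ha => ha.ne rfl
  rintro x (hx | hx) y (hy | hy) hxy
  · obtain ⟨i, hi0, him, hi, rfl⟩ := key x hx
    obtain ⟨j, hj0, hjm, hj, rfl⟩ := key y hy
    rcases lt_trichotomy i j with hlt | rfl | hlt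
    · exact h.not_adj_succ_succ hi hj hi0 hlt hjm hxy
    · exact hxy.ne rfl
    · exact h.not_adj_succ_succ hj hi hj0 hlt him hxy.symm
  · obtain ⟨i, hi0, him, hi, rfl⟩ := key x hx
    exact h.succ_not_adj_off hσ hi hi0 him hy hxy.symm
  · obtain ⟨i, hi0, him, hi, rfl⟩ := key y hy
    exact h.succ_not_adj_off hσ hi hi0 him hx hxy
  · exact h.not_adj_off_off hσ hx hy hxy

end Replaceable

end Degree

section Walk

variable [DecidableEq V] {G : SimpleGraph V} {a : V} {w : G.Walk a a}

/-- The vertices of the closed walk `w`, indexed periodically by the integers. -/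
def periodicVert (w : G.Walk a a) (i : ℤ) : V := w.getVert (i % w.length).toNat

theorem periodicVert_of_lt {i : ℕ} (hi : i < w.length) : periodicVert w i = w.getVert i := by
  have : (i : ℤ) % w.length = i := Int.emod_eq_of_lt (by omega) (by omega)
  simp [periodicVert, this]

theorem periodicVert_add_length (i : ℤ) : periodicVert w (i + w.length) = periodicVert w i := by
  simp [periodicVert]

theorem periodicVert_congr {i j : ℤ} (h : i % w.length = j % w.length) :
    periodicVert w i = periodicVert w j := by
  simp [periodicVert, h]

theorem exists_nat_mod_eq (hw : 0 < w.length) (i : ℤ) :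
    ∃ k : ℕ, k < w.length ∧ i % w.length = (k : ℤ) % w.length := by
  have h1 := Int.emod_nonneg i (b := w.length) (by omega)
  have h2 := Int.emod_lt_of_pos i (b := w.length) (by omega)
  refine ⟨(i % w.length).toNat, by omega, ?_⟩
  rw [Int.toNat_of_nonneg h1, Int.emod_emod]

theorem periodicVert_of_le (hw : 0 < w.length) {i : ℕ} (hi : i ≤ w.length) :
    periodicVert w i = w.getVert i := by
  rcases hi.lt_or_eq with hi | rfl
  · exact periodicVert_of_lt hi
  · have := periodicVert_add_length (w := w) 0
    have h0 := periodicVert_of_lt hw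
    simp at this h0
    simp [this, h0]

theorem mem_support_iff_exists_periodicVert (hw : 0 < w.length) {x : V} :
    x ∈ w.support ↔ ∃ i, x = periodicVert w i := by
  rw [SimpleGraph.Walk.mem_support_iff_exists_getVert]
  constructor
  · rintro ⟨n, rfl, hn⟩
    exact ⟨n, (periodicVert_of_le hw hn).symm⟩
  · rintro ⟨i, rfl⟩
    obtain ⟨k, hk, h⟩ := exists_nat_mod_eq hw i
    exact ⟨k, by rw [periodicVert_congr h, periodicVert_of_lt hk], hk.le⟩

theorem periodicVert_succ (hw : 0 < w.length) (i : ℤ) :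
    ∃ k : ℕ, k < w.length ∧ periodicVert w i = w.getVert k ∧
      periodicVert w (i + 1) = w.getVert (k + 1) := by
  obtain ⟨k, hk, h⟩ := exists_nat_mod_eq hw i
  refine ⟨k, hk, by rw [periodicVert_congr h, periodicVert_of_lt hk], ?_⟩
  have : (i + 1) % w.length = (k + 1) % w.length := Int.ModEq.add_right 1 h
  rw [periodicVert_congr this]
  exact_mod_cast periodicVert_of_le hw (i := k + 1) (by omega)

theorem card_le_of_hasPath (hc : IsLongestCycle G w) {x y : V} {S : Finset V}
    (hp : HasPath G x y S) (hyx : G.Adj y x) : S.card ≤ w.length := by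
  obtain ⟨p, hp, rfl⟩ := hp
  rw [List.toFinset_card_of_nodup hp.support_nodup, SimpleGraph.Walk.length_support]
  have h3 := hc.1.three_le_length
  by_cases h1 : p.length = 1
  · omega
  · have hcyc : (SimpleGraph.Walk.cons hyx p).IsCycle := by
      rw [SimpleGraph.Walk.cons_isCycle_iff]
      refine ⟨hp, fun he => h1 (hp.length_eq_one_of_mem_edges ?_)⟩
      rwa [Sym2.eq_swap]
    simpa using hc.2 _ _ hcyc

theorem isMaxCycle_periodicVert (hc : IsLongestCycle G w) :
    IsMaxCycle G w.length (periodicVert w) where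
  three_le := hc.1.three_le_length
  dvd_of_eq i j hij := by
    have hw : 0 < w.length := by have := hc.1.three_le_length; omega
    obtain ⟨k, hk, hi⟩ := exists_nat_mod_eq hw i
    obtain ⟨l, hl, hj⟩ := exists_nat_mod_eq hw j
    rw [periodicVert_congr hi, periodicVert_congr hj, periodicVert_of_lt hk,
      periodicVert_of_lt hl] at hij
    obtain rfl : k = l := hc.1.getVert_injOn' (Nat.le_sub_one_of_lt hk)
      (Nat.le_sub_one_of_lt hl) hij
    exact Int.ModEq.dvd (hj.trans hi.symm)
  periodic := periodicVert_add_length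
  adj i := by
    obtain ⟨k, hk, h1, h2⟩ := periodicVert_succ
      (by have := hc.1.three_le_length; omega : 0 < w.length) i
    rw [h1, h2]
    exact w.adj_getVert_succ hk
  max _ _ _ hp h := card_le_of_hasPath hc hp h

theorem support_tail_getElem {k : ℕ} (hk : k < w.support.tail.length) :
    w.support.tail[k] = periodicVert w (k + 1 : ℕ) := by
  have hk' : k < w.length := by simpa using hk
  rw [periodicVert_of_le (by omega) hk', List.getElem_tail,
    SimpleGraph.Walk.support_getElem_eq_getVert]

theorem exists_support_tail_getElem (hw : 0 < w.length) (i : ℤ) :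
    ∃ (k : ℕ) (hk : k < w.support.tail.length), periodicVert w i = w.support.tail[k] ∧
      (w.length : ℤ) ∣ i - (k + 1) := by
  obtain ⟨k, hk, h⟩ := exists_nat_mod_eq hw (i - 1)
  have hd : (w.length : ℤ) ∣ i - (k + 1) := by
    have := Int.ModEq.dvd h.symm
    rwa [sub_sub, add_comm 1] at this
  refine ⟨k, by simpa using hk, ?_, hd⟩
  rw [support_tail_getElem]
  refine periodicVert_congr (Int.ModEq.symm ((Int.modEq_iff_dvd).mpr ?_))
  exact_mod_cast hd

theorem periodicVert_congr_of_dvd {i j : ℤ} (h : (w.length : ℤ) ∣ i - j) :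
    periodicVert w j = periodicVert w i :=
  periodicVert_congr (Int.modEq_iff_dvd.mpr h)

theorem cSucc_periodicVert (hc : IsLongestCycle G w) (i : ℤ) :
    cSucc w (periodicVert w i) = periodicVert w (i + 1) := by
  obtain ⟨k, hk, h, hd⟩ := exists_support_tail_getElem
    (by have := hc.1.three_le_length; omega : 0 < w.length) i
  rw [cSucc, dif_pos (by rw [h]; exact List.getElem_mem hk)]
  simp only [h]
  rw [List.next_getElem _ hc.1.support_nodup, support_tail_getElem]
  refine periodicVert_congr_of_dvd ?_
  have : w.support.tail.length = w.length := by simp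
  rw [this]
  push_cast
  have := Int.emod_add_mul_ediv (k + 1) w.length
  rw [show i + 1 - (((k : ℤ) + 1) % w.length + 1)
    = (i - (k + 1)) + w.length * ((k + 1) / w.length) by linarith]
  exact dvd_add hd (dvd_mul_right _ _)

theorem cPred_periodicVert (hc : IsLongestCycle G w) (i : ℤ) :
    cPred w (periodicVert w i) = periodicVert w (i - 1) := by
  have hmem : periodicVert w (i - 1) ∈ w.support.tail := by
    obtain ⟨k, hk, h, -⟩ := exists_support_tail_getElem
      (by have := hc.1.three_le_length; omega : 0 < w.length) (i - 1)
    rw [h]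
    exact List.getElem_mem hk
  have h := cSucc_periodicVert hc (i - 1)
  rw [sub_add_cancel, cSucc, dif_pos hmem] at h
  rw [← h, cPred, dif_pos (List.next_mem _ _ _), List.prev_next _ hc.1.support_nodup]

end Walk

theorem stmt6 {V : Type*} [Fintype V] [DecidableEq V] (G : SimpleGraph V)
    (hn : 3 ≤ Fintype.card V) (htough : OneTough G) (hsig : Fintype.card V ≤ sigma3 G)
    (hham : ¬ G.IsHamiltonian) {a : V} (c : G.Walk a a) (hc : IsLongestCycle G c)
    (u v : V) (hu : u ∉ c.support) (hv : v ∈ c.support)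
    (huv1 : G.Adj u (cSucc c v)) (huv2 : G.Adj u (cPred c v))
    (B : Set V) (hB : B = G.neighborSet u ∪ G.neighborSet v) :
    IsIndepSet G (cSucc c '' B ∪ {x | x ∉ c.support}) ∧
    IsIndepSet G (cPred c '' B ∪ {x | x ∉ c.support}) := by
  have hσ := LargeDegreeSum.of_sigma3 hsig
  have hlen : 0 < c.length := by have := hc.1.three_le_length; omega
  obtain ⟨k, rfl⟩ := (mem_support_iff_exists_periodicVert hlen).mp hv
  have hoff {x : V} : x ∉ c.support ↔ OffCycle (fun i => periodicVert c (i + k)) x := by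
    rw [mem_support_iff_exists_periodicVert hlen, not_exists]
    exact ⟨fun h i => h _, fun h i => by simpa using h (i - k)⟩
  rw [cSucc_periodicVert hc] at huv1
  rw [cPred_periodicVert hc] at huv2
  have h : Replaceable G c.length (fun i => periodicVert c (i + k)) u :=
    { (isMaxCycle_periodicVert hc).shift k with
      off := hoff.mp hu
      adj_one := by rwa [add_comm]
      adj_neg_one := by rwa [add_comm, ← sub_eq_add_neg] }
  have hoff' {x : V} : x ∉ c.support ↔ OffCycle (fun i => periodicVert c (-i + k)) x := by
    rw [hoff]
    exact ⟨fun h i => h (-i), fun h i => by simpa using h (-i)⟩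
  constructor
  · have := h.isIndepSet_image_succ hσ (cSucc c) fun i => by
      rw [cSucc_periodicVert hc, add_right_comm]
    simpa only [← hoff, zero_add, ← hB] using this
  · have := h.reverse.isIndepSet_image_succ hσ (cPred c) fun i => by
      rw [cPred_periodicVert hc]
      congr 1
      ring
    simpa only [← hoff', neg_zero, zero_add, ← hB] using this

end
end Paper
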